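/- Let x_1 < ⋯ < x_n be real points with δ = min_{i≠j} |x_i − x_j| > 0, let σ² > 0, ℓ² > 0, σ_n² > 0, and let K_θ be the squared-exponential Gram matrix. Suppose k ≤ n is chosen such that there exists ε with (K_θ)_{ij} ≤ ε for all |i−j| > k and ε ≤ (3σ_n²δ²)/(4ℓ²)·exp(−3δ²/(2ℓ²)). Then the largest eigenvalue of the symmetric matrix K_θ − L_k(K_θ) is strictly smaller than σ_n². -/

import Mathlib

open Matrix BigOperators

/-- The cut-off operator `L_k`: keeps entries within bandwidth `k`, zeroes the rest. -/
def cutoff {n : ℕ} (k : ℕ) (A : Matrix (Fin n) (Fin n) ℝ) :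
    Matrix (Fin n) (Fin n) ℝ :=
  Matrix.of fun i j => if |(i : ℤ) - (j : ℤ)| ≤ (k : ℤ) then A i j else 0

/-- The squared-exponential Gram matrix `(K_θ)_{ij} = σ² exp(−(x_i−x_j)²/(2ℓ²))`. -/
noncomputable def seGram {n : ℕ} (x : Fin n → ℝ) (σ2 l2 : ℝ) :
    Matrix (Fin n) (Fin n) ℝ :=
  Matrix.of fun i j => σ2 * Real.exp (-(x i - x j) ^ 2 / (2 * l2))

lemma seGram_isHermitian {n : ℕ} (x : Fin n → ℝ) (σ2 l2 : ℝ) :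
    (seGram x σ2 l2).IsHermitian := by
  ext i j
  simp only [seGram, Matrix.conjTranspose_apply, Matrix.of_apply, star_trivial]
  rw [show (x j - x i) ^ 2 = (x i - x j) ^ 2 by ring]

lemma cutoff_isHermitian {n k : ℕ} {A : Matrix (Fin n) (Fin n) ℝ}
    (hA : A.IsHermitian) : (cutoff k A).IsHermitian := by
  ext i j
  simp only [cutoff, Matrix.conjTranspose_apply, Matrix.of_apply, star_trivial]
  rw [abs_sub_comm]
  split
  · exact (Matrix.IsHermitian.apply hA j i).symm ▸ rfl
  · rfl

lemma sum_pow_le_inv_one_sub_of_injOn {ι : Type*} {q : ℝ} (hq0 : 0 ≤ q) (hq1 : q < 1)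
    (s : Finset ι) (g : ι → ℕ) (hg : Set.InjOn g s) :
    ∑ i ∈ s, q ^ g i ≤ (1 - q)⁻¹ := by
  rw [← Finset.sum_image (f := fun m => q ^ m) hg, ← tsum_geometric_of_lt_one hq0 hq1]
  exact (summable_geometric_of_lt_one hq0 hq1).sum_le_tsum _ fun m _ => pow_nonneg hq0 m

lemma nat_mul_le_sub_of_le_abs_sub {n : ℕ} {x : Fin n → ℝ} (hx : StrictMono x) {δ : ℝ}
    (hδ : ∀ i j : Fin n, i ≠ j → δ ≤ |x i - x j|) (m : ℕ) :
    ∀ i j : Fin n, (j : ℕ) = i + m → m * δ ≤ x j - x i := by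
  induction m with
  | zero =>
    intro i j hij
    obtain rfl : j = i := Fin.ext (by simpa using hij)
    simp
  | succ m ih =>
    intro i j hij
    have hlt : (i : ℕ) + m < n := by omega
    have hstep : (⟨i + m, hlt⟩ : Fin n) < j := Fin.lt_def.2 (by simp only; omega)
    have h₁ := ih i ⟨i + m, hlt⟩ rfl
    have h₂ := hδ j ⟨i + m, hlt⟩ hstep.ne'
    rw [abs_of_pos (sub_pos.2 (hx hstep))] at h₂
    push_cast
    linarith

lemma seGram_comm {n : ℕ} (x : Fin n → ℝ) (σ2 l2 : ℝ) (i j : Fin n) :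
    seGram x σ2 l2 i j = seGram x σ2 l2 j i := by
  simp only [seGram, Matrix.of_apply]
  rw [show (x j - x i) ^ 2 = (x i - x j) ^ 2 by ring]

lemma seGram_le_mul_pow {n : ℕ} {x : Fin n → ℝ} (hx : StrictMono x) {σ2 l2 δ E : ℝ}
    (hσ2 : 0 < σ2) (hl2 : 0 < l2) (hδ0 : 0 < δ)
    (hδ : ∀ i j : Fin n, i ≠ j → δ ≤ |x i - x j|) {k : ℕ}
    (hE : ∀ i j : Fin n, (k : ℤ) < |(i : ℤ) - (j : ℤ)| → seGram x σ2 l2 i j ≤ E)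
    {i j : Fin n} (hij : (i : ℕ) + k < j) :
    seGram x σ2 l2 i j ≤ E * Real.exp (-(3 * δ ^ 2) / (2 * l2)) ^ ((j : ℕ) - i - k - 1) := by
  obtain ⟨r, hr⟩ : ∃ r, (j : ℕ) - i - k - 1 = r := ⟨_, rfl⟩
  let p : Fin n := ⟨i + (k + 1), by omega⟩
  have hip : ((k + 1 : ℕ) : ℝ) * δ ≤ x p - x i :=
    nat_mul_le_sub_of_le_abs_sub hx hδ (k + 1) i p rfl
  have hpj : (r : ℝ) * δ ≤ x j - x p :=
    nat_mul_le_sub_of_le_abs_sub hx hδ r p j (by simp only [p]; omega)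
  have hδp : δ ≤ x p - x i := by
    push_cast at hip
    nlinarith [mul_nonneg (Nat.cast_nonneg (α := ℝ) k) hδ0.le]
  have hrr : (r : ℝ) ≤ (r : ℝ) ^ 2 := by exact_mod_cast Nat.le_self_pow two_ne_zero r
  have hr0 : (0 : ℝ) ≤ r * δ := by positivity
  have hsq : (x i - x p) ^ 2 + r * (3 * δ ^ 2) ≤ (x i - x j) ^ 2 := by
    have h₁ : δ * (r * δ) ≤ (x p - x i) * (x j - x p) := mul_le_mul hδp hpj hr0 (by linarith)
    have h₂ : (r * δ) ^ 2 ≤ (x j - x p) ^ 2 := pow_le_pow_left₀ hr0 hpj 2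
    have h₃ : (r : ℝ) * δ ^ 2 ≤ r ^ 2 * δ ^ 2 := by gcongr
    nlinarith
  rw [hr]
  refine le_trans ?_ (mul_le_mul_of_nonneg_right (hE i p ?_) (by positivity))
  · simp only [seGram, Matrix.of_apply]
    rw [mul_assoc, ← Real.exp_nat_mul, ← Real.exp_add]
    gcongr
    rw [← mul_div_assoc, ← add_div]
    gcongr
    linarith
  · rw [abs_sub_comm]
    refine lt_of_lt_of_le ?_ (le_abs_self _)
    simp only [p]
    push_cast
    linarith

lemma sum_seGram_sub_cutoff_le {n : ℕ} {x : Fin n → ℝ} (hx : StrictMono x) {σ2 l2 δ E : ℝ}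
    (hσ2 : 0 < σ2) (hl2 : 0 < l2) (hδ0 : 0 < δ) (hE0 : 0 ≤ E)
    (hδ : ∀ i j : Fin n, i ≠ j → δ ≤ |x i - x j|) {k : ℕ}
    (hE : ∀ i j : Fin n, (k : ℤ) < |(i : ℤ) - (j : ℤ)| → seGram x σ2 l2 i j ≤ E) (i : Fin n) :
    ∑ j, ‖(seGram x σ2 l2 - cutoff k (seGram x σ2 l2)) i j‖ ≤
      2 * E * (1 - Real.exp (-(3 * δ ^ 2) / (2 * l2)))⁻¹ := by
  set q := Real.exp (-(3 * δ ^ 2) / (2 * l2))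
  have hq0 : 0 ≤ q := Real.exp_nonneg _
  have hq1 : q < 1 := Real.exp_lt_one_iff.2 (div_neg_of_neg_of_pos (by nlinarith) (by positivity))
  have hright := sum_pow_le_inv_one_sub_of_injOn hq0 hq1
    (Finset.univ.filter fun j : Fin n => (i : ℕ) + k < j) (fun j => (j : ℕ) - i - k - 1) (by
      intro a ha b hb hab
      simp at ha hb hab
      omega)
  have hleft := sum_pow_le_inv_one_sub_of_injOn hq0 hq1
    (Finset.univ.filter fun j : Fin n => (j : ℕ) + k < i) (fun j => (i : ℕ) - j - k - 1) (by
      intro a ha b hb hab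
      simp at ha hb hab
      omega)
  have hterm : ∀ j : Fin n, ‖(seGram x σ2 l2 - cutoff k (seGram x σ2 l2)) i j‖ ≤
      E * ((if (i : ℕ) + k < j then q ^ ((j : ℕ) - i - k - 1) else 0) +
        (if (j : ℕ) + k < i then q ^ ((i : ℕ) - j - k - 1) else 0)) := by
    intro j
    have hnonneg : 0 ≤ seGram x σ2 l2 i j := by
      simp only [seGram, Matrix.of_apply]; positivity
    rw [Matrix.sub_apply]
    simp only [cutoff, Matrix.of_apply]
    by_cases h₁ : (i : ℕ) + k < j
    · rw [if_neg (by rw [abs_le]; omega), if_pos h₁, if_neg (by omega), sub_zero, add_zero,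
        Real.norm_of_nonneg hnonneg]
      exact seGram_le_mul_pow hx hσ2 hl2 hδ0 hδ hE h₁
    by_cases h₂ : (j : ℕ) + k < i
    · rw [if_neg (by rw [abs_le]; omega), if_neg h₁, if_pos h₂, sub_zero, zero_add,
        Real.norm_of_nonneg hnonneg, seGram_comm]
      exact seGram_le_mul_pow hx hσ2 hl2 hδ0 hδ hE h₂
    · rw [if_pos (by rw [abs_le]; omega), if_neg h₁, if_neg h₂]
      simp
  refine (Finset.sum_le_sum fun j _ => hterm j).trans ?_
  rw [← Finset.mul_sum, Finset.sum_add_distrib, ← Finset.sum_filter, ← Finset.sum_filter]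
  nlinarith [mul_le_mul_of_nonneg_left (add_le_add hright hleft) hE0]

lemma mul_exp_neg_mul_inv_one_sub_exp_neg_lt_one {t : ℝ} (ht : 0 < t) :
    t * Real.exp (-t) * (1 - Real.exp (-t))⁻¹ < 1 := by
  have h₁ : Real.exp (-t) < 1 := Real.exp_lt_one_iff.2 (by linarith)
  rw [← div_eq_mul_inv, div_lt_one (by linarith)]
  have h₂ : Real.exp t * Real.exp (-t) = 1 := by rw [← Real.exp_add]; simp
  nlinarith [Real.add_one_lt_exp ht.ne', Real.exp_pos (-t)]

lemma Matrix.IsHermitian.exists_eigenvalues_le_sum_norm {n : Type*} [Fintype n] [DecidableEq n]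
    {A : Matrix n n ℝ} (hA : A.IsHermitian) (i : n) :
    ∃ k, hA.eigenvalues i ≤ ∑ j, ‖A k j‖ := by
  have hev : Module.End.HasEigenvalue (Matrix.toLin' A) (hA.eigenvalues i) := by
    rw [Module.End.hasEigenvalue_iff_mem_spectrum, Matrix.spectrum_toLin']
    exact hA.eigenvalues_mem_spectrum_real i
  obtain ⟨k, hk⟩ := eigenvalue_mem_ball hev
  refine ⟨k, ?_⟩
  rw [Metric.mem_closedBall, Real.dist_eq] at hk
  rw [← Finset.add_sum_erase _ _ (Finset.mem_univ k), Real.norm_eq_abs]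
  linarith [le_abs_self (hA.eigenvalues i - A k k), le_abs_self (A k k)]

/-- **Tail eigenvalue bound.** Under the BTC bandwidth condition,
`λ_max(K_θ − L_k(K_θ)) < σ_n²`. -/
theorem eigenvalue_max_seGram_sub_cutoff_lt {n : ℕ} (k : ℕ) (hk : k ≤ n)
    (x : Fin n → ℝ) (hx : StrictMono x)
    (σ2 l2 σn2 δ : ℝ) (hσ2 : 0 < σ2) (hl2 : 0 < l2) (hσn2 : 0 < σn2)
    (hδ : IsLeast {d : ℝ | ∃ i j : Fin n, i ≠ j ∧ d = |x i - x j|} δ) (hδ0 : 0 < δ)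
    (ε : ℝ)
    (hε : ∀ i j : Fin n, (k : ℤ) < |(i : ℤ) - (j : ℤ)| → seGram x σ2 l2 i j ≤ ε)
    (hεbound : ε ≤ 3 * σn2 * δ ^ 2 / (4 * l2) * Real.exp (-(3 * δ ^ 2) / (2 * l2))) :
    (⨆ i : Fin n,
      (((seGram_isHermitian x σ2 l2).sub
        (cutoff_isHermitian (k := k) (seGram_isHermitian x σ2 l2))).eigenvalues i))
      < σn2 := by
  obtain ⟨⟨a, -⟩, hmin⟩ := hδ
  have hsep : ∀ i j : Fin n, i ≠ j → δ ≤ |x i - x j| := fun i j hij => hmin ⟨i, j, hij, rfl⟩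
  have : Nonempty (Fin n) := ⟨a⟩
  obtain ⟨i, hi⟩ := exists_eq_ciSup_of_finite (f := fun i : Fin n =>
    ((seGram_isHermitian x σ2 l2).sub
      (cutoff_isHermitian (k := k) (seGram_isHermitian x σ2 l2))).eigenvalues i)
  rw [← hi]
  obtain ⟨r, hr⟩ := ((seGram_isHermitian x σ2 l2).sub
    (cutoff_isHermitian (k := k) (seGram_isHermitian x σ2 l2))).exists_eigenvalues_le_sum_norm i
  refine (hr.trans (sum_seGram_sub_cutoff_le hx hσ2 hl2 hδ0 (by positivity) hsep
    (fun i j hij => (hε i j hij).trans hεbound) r)).trans_lt ?_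
  have ht := mul_exp_neg_mul_inv_one_sub_exp_neg_lt_one
    (t := 3 * δ ^ 2 / (2 * l2)) (by positivity)
  rw [← neg_div] at ht
  calc _ = σn2 * (3 * δ ^ 2 / (2 * l2) * Real.exp (-(3 * δ ^ 2) / (2 * l2)) *
        (1 - Real.exp (-(3 * δ ^ 2) / (2 * l2)))⁻¹) := by ring
    _ < σn2 := mul_lt_of_lt_one_right hσn2 ht
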